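/- arXiv:1812.04208 — 8 statements merged into one kernel-verified Lean document; each statement's English description precedes it below -/
import Mathlib

section
/- Let (R, m) be a commutative Noetherian complete local ring which is flat as a ℤ_p-module and whose residue field R/m has characteristic p. Then the set of prime ideals 𝔭 of R such that the quotient R/𝔭 is an integral domain of characteristic 0 and of Krull dimension 1 is Zariski dense in Spec R. -/
/-- A Noetherian local domain in which every nonzero prime ideal contains a fixed nonzero element
of the maximal ideal has Krull dimension one. -/
theorem ringKrullDim_eq_one_of_forall_isPrime_mem {A : Type*} [CommRing A] [IsDomain A]
    [IsNoetherianRing A] [IsLocalRing A] {g : A} (hg0 : g ≠ 0)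
    (hgm : g ∈ IsLocalRing.maximalIdeal A)
    (hg : ∀ P : Ideal A, P.IsPrime → P ≠ ⊥ → g ∈ P) : ringKrullDim A = 1 := by
  have hm : (⊥ : Ideal A) < IsLocalRing.maximalIdeal A := by
    refine bot_lt_iff_ne_bot.mpr fun h ↦ hg0 ?_
    rwa [h, Ideal.mem_bot] at hgm
  have bot_add {P : Ideal A} [P.IsPrime] (hP : P ≠ ⊥) : 1 ≤ P.height :=
    le_add_self.trans (Ideal.height_add_one_le_of_lt_of_isPrime (bot_lt_iff_ne_bot.mpr hP))
  suffices h : ∃ Q ∈ (Ideal.span {g}).minimalPrimes, IsLocalRing.maximalIdeal A ≤ Q by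
    obtain ⟨Q, hQ, hmQ⟩ := h
    have hQp : Q.IsPrime := hQ.1.1
    rw [← IsLocalRing.maximalIdeal_height_eq_ringKrullDim]
    have h1 : (IsLocalRing.maximalIdeal A).height ≤ 1 :=
      (Ideal.height_mono hmQ).trans
        (Ideal.height_le_one_of_isPrincipal_of_mem_minimalPrimes (Ideal.span {g}) Q hQ)
    exact_mod_cast le_antisymm h1 (bot_add hm.ne')
  rw [← Ideal.subset_union_prime_finite (f := fun Q ↦ Q)
    (Ideal.finite_minimalPrimes_of_isNoetherianRing A (Ideal.span {g})) ⊥ ⊥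
    (fun Q hQ _ _ ↦ hQ.1.1)]
  intro x hx
  obtain ⟨P, hP, hPm⟩ := Ideal.exists_minimalPrimes_le
    ((Ideal.span_singleton_le_iff_mem _).mpr hx)
  have hPp : P.IsPrime := hP.1.1
  have hxP : x ∈ P := hP.1.2 (Ideal.mem_span_singleton_self x)
  by_cases hx0 : P = ⊥
  · obtain ⟨Q, hQ, -⟩ := Ideal.exists_minimalPrimes_le
      ((Ideal.span_singleton_le_iff_mem _).mpr hgm)
    refine Set.mem_biUnion hQ ?_
    rw [hx0, Ideal.mem_bot] at hxP
    exact hxP ▸ Q.zero_mem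
  have hP1 := Ideal.height_le_one_of_isPrincipal_of_mem_minimalPrimes (Ideal.span {x}) P hP
  obtain ⟨Q, hQ, hQP⟩ := Ideal.exists_minimalPrimes_le
    ((Ideal.span_singleton_le_iff_mem _).mpr (hg P hPp hx0))
  have hQp : Q.IsPrime := hQ.1.1
  have hQ0 : Q ≠ ⊥ := fun h ↦ hg0 <| by
    simpa [h] using hQ.1.2 (Ideal.mem_span_singleton_self g)
  refine Set.mem_biUnion hQ ?_
  suffices Q = P from this ▸ hxP
  refine eq_of_le_of_not_lt hQP fun hlt ↦ ?_
  have h2 := (Ideal.height_add_one_le_of_lt_of_isPrime hlt).trans hP1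
  have h3 : (1 + 1 : ℕ∞) ≤ 1 := (add_le_add_left (bot_add hQ0) 1).trans h2
  exact absurd h3 (by decide)

/-- In a Noetherian local ring, an element `g` of the maximal ideal that is not nilpotent avoids
some prime ideal with one-dimensional quotient. -/
theorem exists_isPrime_notMem_ringKrullDim_quotient_eq_one {R : Type*} [CommRing R]
    [IsNoetherianRing R] [IsLocalRing R] {g : R} (hg : ¬ IsNilpotent g)
    (hgm : g ∈ IsLocalRing.maximalIdeal R) :
    ∃ P : Ideal R, P.IsPrime ∧ g ∉ P ∧ ringKrullDim (R ⧸ P) = 1 := by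
  have hne : {P : Ideal R | P.IsPrime ∧ g ∉ P}.Nonempty := by
    by_contra! h
    refine hg (nilpotent_iff_mem_prime.mpr fun J hJ ↦ ?_)
    by_contra hgJ
    exact h.le (show J ∈ {P : Ideal R | P.IsPrime ∧ g ∉ P} from ⟨hJ, hgJ⟩)
  obtain ⟨P, ⟨hP, hgP⟩, hmax⟩ := set_has_maximal_iff_noetherian.mpr ‹IsNoetherianRing R› _ hne
  refine ⟨P, hP, hgP, ?_⟩
  have : IsLocalRing (R ⧸ P) := .of_surjective' _ Ideal.Quotient.mk_surjective
  refine ringKrullDim_eq_one_of_forall_isPrime_mem (g := Ideal.Quotient.mk P g)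
    (by rwa [ne_eq, Ideal.Quotient.eq_zero_iff_mem]) ?_ fun Q hQ hQ0 ↦ ?_
  · rw [IsLocalRing.mem_maximalIdeal, mem_nonunits_iff] at hgm ⊢
    have := IsLocalHom.of_surjective (Ideal.Quotient.mk P) Ideal.Quotient.mk_surjective
    rwa [isUnit_map_iff]
  · by_contra hgQ
    refine hmax (Q.comap (Ideal.Quotient.mk P)) ⟨hQ.comap _, hgQ⟩ ?_
    refine lt_of_le_of_ne (fun x hx ↦ ?_) fun h ↦ hQ0 ?_
    · rw [Ideal.mem_comap, Ideal.Quotient.eq_zero_iff_mem.mpr hx]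
      exact Q.zero_mem
    · rw [← Ideal.map_comap_of_surjective _ Ideal.Quotient.mk_surjective Q, ← h,
        Ideal.map_quotient_self]

/-- Let `(R, m)` be a commutative Noetherian complete local ring which is flat as a
`ℤ_p`-module and whose residue field `R/m` has characteristic `p`. Then the set of prime
ideals `𝔭` of `R` such that `R/𝔭` is an integral domain of characteristic `0` and of
Krull dimension `1` is Zariski dense in `Spec R`. -/
theorem stmt1 (p : ℕ) [Fact p.Prime] (R : Type*) [CommRing R] [IsNoetherianRing R]
    [IsLocalRing R] [IsAdicComplete (IsLocalRing.maximalIdeal R) R]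
    [Algebra ℤ_[p] R] [Module.Flat ℤ_[p] R]
    [CharP (IsLocalRing.ResidueField R) p] :
    Dense {𝔭 : PrimeSpectrum R |
      IsDomain (R ⧸ 𝔭.asIdeal) ∧
      CharZero (R ⧸ 𝔭.asIdeal) ∧
      ringKrullDim (R ⧸ 𝔭.asIdeal) = 1} := by
  have hpm : (p : R) ∈ IsLocalRing.maximalIdeal R := by
    rw [← IsLocalRing.residue_eq_zero_iff, map_natCast, CharP.cast_eq_zero]
  have hreg (k : ℕ) (x : R) (h : (p : R) ^ k * x = 0) : x = 0 := by
    have h' : ((p : ℤ_[p]) ^ k) • x = 0 := by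
      rwa [Algebra.smul_def, map_pow, map_natCast]
    exact (smul_eq_zero.mp h').resolve_left
      (pow_ne_zero _ (Nat.cast_ne_zero.mpr (Fact.out : p.Prime).ne_zero))
  refine PrimeSpectrum.isTopologicalBasis_basic_opens.dense_iff.mpr ?_
  rintro _ ⟨f, rfl⟩ hne
  have hf : ¬ IsNilpotent f := fun h ↦ by
    rw [← PrimeSpectrum.basicOpen_eq_bot_iff] at h
    simp [h] at hne
  have hpf : ¬ IsNilpotent ((p : R) * f) := fun ⟨n, hn⟩ ↦
    hf ⟨n, hreg n _ (by rwa [mul_pow] at hn)⟩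
  obtain ⟨P, hP, hgP, hdim⟩ := exists_isPrime_notMem_ringKrullDim_quotient_eq_one hpf
    (Ideal.mul_mem_right _ _ hpm)
  have hpP : (p : R) ∉ P := fun h ↦ hgP (P.mul_mem_right _ h)
  refine ⟨⟨P, hP⟩, fun h ↦ hgP (P.mul_mem_left _ h), Ideal.Quotient.isDomain P, ?_, hdim⟩
  refine charZero_of_inj_zero fun n hn ↦ ?_
  by_contra hn0
  obtain ⟨k, m, hm, rfl⟩ := Nat.exists_eq_pow_mul_and_not_dvd hn0 p (Fact.out : p.Prime).ne_one
  have hunit : IsUnit (m : R) := by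
    rw [← IsLocalRing.residue_ne_zero_iff_isUnit, map_natCast]
    rwa [ne_eq, CharP.cast_eq_zero_iff _ p]
  rw [← map_natCast (Ideal.Quotient.mk P), Ideal.Quotient.eq_zero_iff_mem] at hn
  push_cast at hn
  rcases hP.mem_or_mem hn with h | h
  · exact hpP (hP.mem_of_pow_mem _ h)
  · exact hP.ne_top (Ideal.eq_top_of_isUnit_mem _ h hunit)
end

section
/- Let (R, m) be a commutative Noetherian complete local ring which is flat as a ℤ_p-module and whose residue field k = R/m is perfect of characteristic p. Then R contains a copy of the ring of Witt vectors W(k): there exists an injective ring homomorphism W(k) → R whose composition with the quotient map R → k is the canonical projection W(k) → k. -/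
open IsLocalRing WittVector IsAdicComplete

theorem IsLocalRing.natCast_mem_maximalIdeal {p : ℕ} {R : Type*} [CommRing R] [IsLocalRing R]
    [CharP (ResidueField R) p] : (p : R) ∈ maximalIdeal R := by
  rw [← residue_eq_zero_iff, map_natCast, CharP.cast_eq_zero]

section WittLift

variable {p : ℕ} [hp : Fact p.Prime] {R : Type*} [CommRing R] [IsLocalRing R]
  [CharP (ResidueField R) p]

/-- If all coefficients of a Witt vector lie in the maximal ideal `m`, then its `n`-th ghost
component lies in `m ^ (n + 1)`. -/
theorem ker_map_residue_le_ker_mk_comp_ghostComponent (n : ℕ) :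
    RingHom.ker (WittVector.map (p := p) (residue R)) ≤
      RingHom.ker ((Ideal.Quotient.mk (maximalIdeal R ^ (n + 1))).comp
        (ghostComponent (p := p) n)) := by
  intro x hx
  have hcoeff (i : ℕ) : x.coeff i ∈ maximalIdeal R := by
    rw [← residue_eq_zero_iff, ← WittVector.map_coeff, RingHom.mem_ker.mp hx, zero_coeff]
  rw [RingHom.mem_ker, RingHom.comp_apply, Ideal.Quotient.eq_zero_iff_mem, ghostComponent_apply,
    aeval_wittPolynomial]
  refine Ideal.sum_mem _ fun i hi ↦ ?_
  have hi' : i ≤ n := Nat.lt_succ_iff.mp (Finset.mem_range.mp hi)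
  have hlt : n - i < p ^ (n - i) := Nat.lt_pow_self hp.out.one_lt
  refine Ideal.pow_le_pow_right (show n + 1 ≤ i + p ^ (n - i) by omega) ?_
  rw [pow_add]
  exact Ideal.mul_mem_mul (Ideal.pow_mem_pow natCast_mem_maximalIdeal _)
    (Ideal.pow_mem_pow (hcoeff i) _)

variable (p R) in
/-- The ring homomorphism `W(k) → R / m ^ (n + 1)` induced by the `n`-th ghost component. -/
noncomputable def ghostComponentModPow (n : ℕ) :
    WittVector p (ResidueField R) →+* R ⧸ maximalIdeal R ^ (n + 1) :=
  RingHom.liftOfSurjective (WittVector.map (residue R))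
    (map_surjective _ residue_surjective)
    ⟨(Ideal.Quotient.mk (maximalIdeal R ^ (n + 1))).comp (ghostComponent n),
      ker_map_residue_le_ker_mk_comp_ghostComponent n⟩

theorem ghostComponentModPow_map_residue (n : ℕ) (x : WittVector p R) :
    ghostComponentModPow p R n (WittVector.map (residue R) x) =
      Ideal.Quotient.mk _ (ghostComponent n x) :=
  RingHom.liftOfSurjective_comp_apply ..

theorem ghostComponentModPow_teichmuller_residue (n : ℕ) (a : R) :
    ghostComponentModPow p R n (teichmuller p (residue R a)) =
      Ideal.Quotient.mk _ (a ^ p ^ n) := by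
  rw [← map_teichmuller, ghostComponentModPow_map_residue, ghostComponent_teichmuller]

variable [PerfectRing (ResidueField R) p]

variable (p R) in
/-- The canonical ring homomorphism `W(k) → R / m ^ (n + 1)`: the inverse of the `n`-th iterate
of Frobenius followed by the `n`-th ghost component. -/
noncomputable def wittLiftModPow (n : ℕ) :
    WittVector p (ResidueField R) →+* R ⧸ maximalIdeal R ^ (n + 1) :=
  (ghostComponentModPow p R n).comp
    (WittVector.map (iterateFrobeniusEquiv (ResidueField R) p n).symm.toRingHom)

theorem wittLiftModPow_teichmuller (n : ℕ) (a : R) (x : ResidueField R)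
    (h : residue R a ^ p ^ n = x) :
    wittLiftModPow p R n (teichmuller p x) = Ideal.Quotient.mk _ (a ^ p ^ n) := by
  have hx : (iterateFrobeniusEquiv (ResidueField R) p n).symm.toRingHom x = residue R a := by
    change (iterateFrobeniusEquiv (ResidueField R) p n).symm x = _
    rw [RingEquiv.symm_apply_eq, iterateFrobeniusEquiv_apply, iterateFrobenius_def, h]
  rw [wittLiftModPow, RingHom.comp_apply, map_teichmuller, hx,
    ghostComponentModPow_teichmuller_residue]

theorem factorPowSucc_comp_wittLiftModPow (n : ℕ) :
    (Ideal.Quotient.factorPowSucc _ _).comp (wittLiftModPow p R (n + 1)) =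
      wittLiftModPow p R n := by
  refine eq_of_apply_teichmuller_eq _ _ ⟨n + 1, ?_⟩ fun x ↦ ?_
  · rw [← map_natCast (Ideal.Quotient.mk (maximalIdeal R ^ (n + 1))), ← map_pow,
      Ideal.Quotient.eq_zero_iff_mem]
    exact Ideal.pow_mem_pow natCast_mem_maximalIdeal _
  · obtain ⟨y, rfl⟩ := (iterateFrobeniusEquiv (ResidueField R) p (n + 1)).surjective x
    obtain ⟨a, rfl⟩ := residue_surjective y
    rw [iterateFrobeniusEquiv_apply, iterateFrobenius_def, RingHom.comp_apply,
      wittLiftModPow_teichmuller (n + 1) a _ rfl,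
      wittLiftModPow_teichmuller n (a ^ p) _ (by rw [map_pow, ← pow_mul, pow_succ']),
      ← pow_mul, ← pow_succ']
    rfl

variable [IsAdicComplete (maximalIdeal R) R]

variable (p R) in
/-- The canonical ring homomorphism from the Witt vectors of the residue field. -/
noncomputable def wittLift : WittVector p (ResidueField R) →+* R :=
  Order.succ_strictMono.liftRingHom (maximalIdeal R) (wittLiftModPow p R)
    (factorPowSucc_comp_wittLiftModPow _)

theorem mk_wittLift (n : ℕ) (x : WittVector p (ResidueField R)) :
    Ideal.Quotient.mk (maximalIdeal R ^ (n + 1)) (wittLift p R x) = wittLiftModPow p R n x :=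
  Order.succ_strictMono.mk_liftRingHom (maximalIdeal R) (wittLiftModPow p R)
    (factorPowSucc_comp_wittLiftModPow _) x

theorem residue_wittLift (x : WittVector p (ResidueField R)) :
    residue R (wittLift p R x) = x.coeff 0 := by
  obtain ⟨y, hy⟩ := map_surjective (residue R) residue_surjective
    (WittVector.map (iterateFrobeniusEquiv (ResidueField R) p 0).symm.toRingHom x)
  have h := mk_wittLift 0 x
  rw [wittLiftModPow, RingHom.comp_apply, ← hy, ghostComponentModPow_map_residue,
    Ideal.Quotient.eq, zero_add, pow_one, ← residue_eq_zero_iff, map_sub, sub_eq_zero,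
    ghostComponent_apply, wittPolynomial_zero, MvPolynomial.aeval_X, ← WittVector.map_coeff,
    hy, WittVector.map_coeff] at h
  rw [h]
  change (iterateFrobeniusEquiv (ResidueField R) p 0).symm _ = _
  rw [RingEquiv.symm_apply_eq, iterateFrobeniusEquiv_apply, iterateFrobenius_def, pow_zero,
    pow_one]

end WittLift

/-- A nonzero Witt vector over a perfect field is a power of `p` times a unit, so a ring
homomorphism to a nontrivial ring in which `p` is a nonzerodivisor is injective. -/
theorem WittVector.ringHom_injective_of_isRegular {p : ℕ} [Fact p.Prime] {k S : Type*} [Field k]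
    [CharP k p] [PerfectRing k p] [CommRing S] [Nontrivial S] (hS : IsRegular (p : S))
    (f : WittVector p k →+* S) : Function.Injective f := by
  rw [injective_iff_map_eq_zero]
  intro x hx
  by_contra hne
  obtain ⟨n, u, rfl⟩ := exists_eq_pow_p_mul' x hne
  rw [map_mul, map_pow, map_natCast] at hx
  have h0 : f (u : WittVector p k) = 0 :=
    (hS.pow n).left (by simpa using hx)
  exact (u.isUnit.map f).ne_zero h0


/-- Let `(R, m)` be a commutative Noetherian complete local ring which is flat as a
`ℤ_p`-module and whose residue field `k = R/m` is perfect of characteristic `p`. Then `R`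
contains a copy of the Witt vectors `W(k)`: there is an injective ring homomorphism
`W(k) → R` whose composition with the quotient map `R → k` sends a Witt vector to its
first coordinate. -/
theorem stmt2 (p : ℕ) [Fact p.Prime] (R : Type*) [CommRing R] [IsNoetherianRing R]
    [IsLocalRing R] [IsAdicComplete (IsLocalRing.maximalIdeal R) R]
    [Algebra ℤ_[p] R] [Module.Flat ℤ_[p] R]
    [CharP (IsLocalRing.ResidueField R) p] [PerfectRing (IsLocalRing.ResidueField R) p] :
    ∃ f : WittVector p (IsLocalRing.ResidueField R) →+* R,
      Function.Injective f ∧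
      ∀ w : WittVector p (IsLocalRing.ResidueField R),
        IsLocalRing.residue R (f w) = w.coeff 0 := by
  have hreg : IsRegular (p : R) := by
    have h := Module.Flat.isSMulRegular_of_nonZeroDivisors (R := ℤ_[p]) (M := R) (r := p)
        (mem_nonZeroDivisors_of_ne_zero (Nat.cast_ne_zero.mpr (Fact.out : p.Prime).ne_zero))
    rw [Commute.isRegular_iff (Commute.all (p : R)), isLeftRegular_iff]
    intro a b hab
    exact h (by simpa [Algebra.smul_def] using hab)
  exact ⟨wittLift p R, WittVector.ringHom_injective_of_isRegular hreg _, residue_wittLift⟩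
end

section
/- Let (R, m) be a commutative Noetherian complete local ring which is flat as a ℤ_p-module, which is an integral domain of Krull dimension 1, and whose residue field k = R/m is perfect of characteristic p. Fix an injective ring homomorphism ι : W(k) → R lifting the identity on residue fields. Then R is a finitely generated module over W(k) (via ι). -/
/-- A finite product of `I`-adically precomplete modules is `I`-adically precomplete. -/
theorem IsPrecomplete.pi {A ι : Type*} [CommRing A] [Finite ι] (I : Ideal A) (M : ι → Type*)
    [∀ i, AddCommGroup (M i)] [∀ i, Module A (M i)] [∀ i, IsPrecomplete I (M i)] :
    IsPrecomplete I (∀ i, M i) := by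
  classical
  have := Fintype.ofFinite ι
  refine ⟨fun f hf ↦ ?_⟩
  have hproj (i : ι) (n : ℕ) (x : ∀ i, M i) (hx : x ∈ (I ^ n • ⊤ : Submodule A (∀ i, M i))) :
      x i ∈ (I ^ n • ⊤ : Submodule A (M i)) := by
    have := Submodule.mem_map_of_mem (f := LinearMap.proj (R := A) (φ := M) i) hx
    rw [Submodule.map_smul''] at this
    exact Submodule.smul_mono le_rfl le_top this
  have hlim (i : ι) : ∃ L : M i, ∀ n, f n i ≡ L [SMOD (I ^ n • ⊤ : Submodule A (M i))] := by
    refine IsPrecomplete.prec' (fun n ↦ f n i) fun {m n} hmn ↦ ?_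
    have := hf hmn
    rw [SModEq.sub_mem] at this ⊢
    exact hproj i m _ this
  choose L hL using hlim
  refine ⟨L, fun n ↦ ?_⟩
  rw [SModEq.sub_mem, ← Finset.univ_sum_single (f n - L)]
  refine Submodule.sum_mem _ fun i _ ↦ ?_
  have hmem : (f n - L) i ∈ (I ^ n • ⊤ : Submodule A (M i)) := SModEq.sub_mem.mp (hL i n)
  have := Submodule.mem_map_of_mem (f := LinearMap.single A M i) hmem
  rw [Submodule.map_smul''] at this
  exact Submodule.smul_mono le_rfl le_top this

/-- Nakayama's lemma over a complete base: an `I`-adically separated module which is generated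
modulo `I` by a finitely generated submodule is finite. -/
theorem Module.Finite.of_fg_sup_smul_eq_top {A M : Type*} [CommRing A] [AddCommGroup M]
    [Module A M] (I : Ideal A) [IsPrecomplete I A] [IsHausdorff I M] {N : Submodule A M}
    (hN : N.FG) (h : N ⊔ I • ⊤ = ⊤) : Module.Finite A M := by
  have : Module.Finite A N := Module.Finite.iff_fg.mpr hN
  obtain ⟨n, g, hg⟩ := Module.Finite.exists_fin' A N
  have : IsPrecomplete I (Fin n → A) := IsPrecomplete.pi I fun _ ↦ A
  refine Module.Finite.of_surjective (N.subtype ∘ₗ g)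
    (surjective_of_mkQ_comp_surjective (I := I) ?_)
  rw [← LinearMap.range_eq_top, LinearMap.range_comp, LinearMap.range_comp,
    LinearMap.range_eq_top.mpr hg, Submodule.map_top, Submodule.range_subtype,
    Submodule.map_mkQ_eq_top, sup_comm]
  exact h

/-- If `A` surjects onto `R ⧸ m`, then `R` is generated over `A` by finitely many elements modulo
any power of `m`. -/
theorem Ideal.exists_fg_sup_pow_eq_top {A R : Type*} [CommRing A] [CommRing R] [Algebra A R]
    [IsNoetherianRing R] (m : Ideal R) (hA : ∀ x : R, ∃ a : A, x - algebraMap A R a ∈ m) (n : ℕ) :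
    ∃ N : Submodule A R, N.FG ∧ N ⊔ (m ^ n).restrictScalars A = ⊤ := by
  induction n with
  | zero => exact ⟨⊥, Submodule.fg_bot, by simp⟩
  | succ n ih =>
    obtain ⟨N, hN, hsup⟩ := ih
    obtain ⟨s, hs⟩ := IsNoetherian.noetherian (m ^ n)
    refine ⟨N ⊔ Submodule.span A s, hN.sup ⟨s, rfl⟩, eq_top_iff.mpr ?_⟩
    rw [← hsup, sup_assoc]
    refine sup_le_sup_left (fun x hx ↦ ?_) N
    rw [Submodule.restrictScalars_mem, ← hs] at hx
    induction hx using Submodule.span_induction with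
    | mem x h => exact Submodule.mem_sup_left (Submodule.subset_span h)
    | zero => exact zero_mem _
    | add x y _ _ hx hy => exact add_mem hx hy
    | smul r x hx ih =>
      obtain ⟨a, ha⟩ := hA r
      have hxm : x ∈ m ^ n := hs ▸ hx
      have heq : r • x = a • x + (r - algebraMap A R a) * x := by
        rw [Algebra.smul_def a, smul_eq_mul]; ring
      rw [heq]
      refine add_mem (Submodule.smul_mem _ a ih) (Submodule.mem_sup_right ?_)
      rw [Submodule.restrictScalars_mem, pow_succ']
      exact Ideal.mul_mem_mul ha hxm

/-- In a one-dimensional Noetherian local domain, every nonzero element divides all elements of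
some power of the maximal ideal. -/
theorem IsLocalRing.exists_maximalIdeal_pow_le_span_singleton {R : Type*} [CommRing R]
    [IsNoetherianRing R] [IsLocalRing R] [IsDomain R] [Ring.KrullDimLE 1 R] {x : R} (hx : x ≠ 0) :
    ∃ n : ℕ, maximalIdeal R ^ n ≤ Ideal.span {x} := by
  refine Ideal.exists_pow_le_of_le_radical_of_fg ?_ (IsNoetherian.noetherian _)
  rw [Ideal.radical_eq_sInf]
  refine le_sInf fun P ⟨hxP, hP⟩ ↦ ?_
  have hbot : P ≠ ⊥ := fun h ↦ hx (by simpa [h] using hxP)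
  exact (IsLocalRing.eq_maximalIdeal (hP.isMaximal_of_ne_bot hbot)).ge

/-- Let `(R, m)` be a commutative Noetherian complete local ring which is flat as a
`ℤ_p`-module, an integral domain of Krull dimension `1`, with perfect residue field
`k = R/m` of characteristic `p`. If `ι : W(k) → R` is an injective ring homomorphism
lifting the identity on residue fields, then `R` is a finitely generated `W(k)`-module. -/
theorem stmt3 (p : ℕ) [Fact p.Prime] (R : Type*) [CommRing R] [IsNoetherianRing R]
    [IsLocalRing R] [IsAdicComplete (IsLocalRing.maximalIdeal R) R]
    [Algebra ℤ_[p] R] [Module.Flat ℤ_[p] R]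
    [IsDomain R] (hdim : ringKrullDim R = 1)
    [CharP (IsLocalRing.ResidueField R) p] [PerfectRing (IsLocalRing.ResidueField R) p]
    [Algebra (WittVector p (IsLocalRing.ResidueField R)) R]
    (hinj : Function.Injective
      (algebraMap (WittVector p (IsLocalRing.ResidueField R)) R))
    (hres : ∀ w : WittVector p (IsLocalRing.ResidueField R),
      IsLocalRing.residue R (algebraMap (WittVector p (IsLocalRing.ResidueField R)) R w)
        = w.coeff 0) :
    Module.Finite (WittVector p (IsLocalRing.ResidueField R)) R := by
  let A := WittVector p (IsLocalRing.ResidueField R)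
  let I : Ideal A := Ideal.span {(p : A)}
  have : Ring.KrullDimLE 1 R := Ring.krullDimLE_iff.mpr hdim.le
  have hp : (p : R) ≠ 0 := by
    rw [← map_natCast (algebraMap A R)]
    exact (map_ne_zero_iff _ hinj).mpr (WittVector.p_nonzero p _)
  have hpm : (p : R) ∈ IsLocalRing.maximalIdeal R := by
    rw [← IsLocalRing.residue_eq_zero_iff, map_natCast, CharP.cast_eq_zero]
  have hmap : I.map (algebraMap A R) = Ideal.span {(p : R)} := by
    rw [Ideal.map_span, Set.image_singleton, map_natCast]
  have : IsHausdorff I R := IsHausdorff.of_map (J := IsLocalRing.maximalIdeal R) <| by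
    rw [hmap]
    exact (Ideal.span_singleton_le_iff_mem _).mpr hpm
  obtain ⟨n, hn⟩ := IsLocalRing.exists_maximalIdeal_pow_le_span_singleton hp
  obtain ⟨N, hN, hsup⟩ := (IsLocalRing.maximalIdeal R).exists_fg_sup_pow_eq_top (A := A)
    (fun x ↦ by
      refine ⟨WittVector.teichmuller p (IsLocalRing.residue R x), ?_⟩
      rw [← IsLocalRing.residue_eq_zero_iff, map_sub, hres, WittVector.teichmuller_coeff_zero,
        sub_self]) n
  refine Module.Finite.of_fg_sup_smul_eq_top I hN (eq_top_iff.mpr ?_)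
  rw [Ideal.smul_top_eq_map, hmap, ← hsup]
  exact sup_le_sup_left (Submodule.restrictScalars_mono A hn) N
end

section
/- Let (R, m) be a commutative Noetherian complete local ring which is flat as a ℤ_p-module, which is an integral domain of Krull dimension 1, and whose residue field k = R/m is perfect of characteristic p. Fix an injective ring homomorphism ι : W(k) → R lifting the identity on residue fields. Then the integral closure of R inside its field of fractions Frac(R) is a finitely generated module over W(k) (via ι). -/
theorem IsPrecomplete.pi_span_singleton {A ι : Type*} [CommRing A] (a : A)
    [IsPrecomplete (Ideal.span {a}) A] : IsPrecomplete (Ideal.span {a}) (ι → A) := by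
  have mem_iff (n : ℕ) (x : ι → A) :
      x ∈ (Ideal.span {a} ^ n • ⊤ : Submodule A (ι → A)) ↔ ∀ i, a ^ n ∣ x i := by
    rw [Ideal.span_singleton_pow, Submodule.ideal_span_singleton_smul, Submodule.mem_smul_pointwise_iff_exists]
    constructor
    · rintro ⟨y, -, rfl⟩ i
      exact ⟨y i, rfl⟩
    · intro h
      choose y hy using h
      exact ⟨y, trivial, funext fun i => (hy i).symm⟩
  have mem_iff' (n : ℕ) (x : A) : x ∈ (Ideal.span {a} ^ n • ⊤ : Submodule A A) ↔ a ^ n ∣ x := by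
    rw [Ideal.span_singleton_pow, smul_eq_mul, Ideal.mul_top, Ideal.mem_span_singleton]
  refine ⟨fun f hf => ?_⟩
  simp only [SModEq.sub_mem, mem_iff, Pi.sub_apply] at hf ⊢
  have key (i : ι) : ∃ L : A, ∀ n, f n i ≡ L [SMOD (Ideal.span {a} ^ n • ⊤ : Submodule A A)] :=
    IsPrecomplete.prec inferInstance fun {m n} hmn => by
      rw [SModEq.sub_mem, mem_iff']
      exact hf hmn i
  choose L hL using key
  refine ⟨L, fun n i => ?_⟩
  rw [← mem_iff', ← SModEq.sub_mem]
  exact hL i n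

/-- A module that is separated for a principal ideal along which the base ring is complete is
finite as soon as its reduction is. -/
theorem Module.Finite.of_quotient_span_singleton_smul_top {A M : Type*} [CommRing A]
    [AddCommGroup M] [Module A M] (a : A) [IsPrecomplete (Ideal.span {a}) A]
    [IsHausdorff (Ideal.span {a}) M]
    [Module.Finite A (M ⧸ (Ideal.span {a} • ⊤ : Submodule A M))] : Module.Finite A M := by
  obtain ⟨n, g, hg⟩ := Module.Finite.exists_fin' A (M ⧸ (Ideal.span {a} • ⊤ : Submodule A M))
  obtain ⟨f, hf⟩ := Module.projective_lifting_property
    (Submodule.mkQ (Ideal.span {a} • ⊤ : Submodule A M)) g (Submodule.mkQ_surjective _)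
  have : IsPrecomplete (Ideal.span {a}) (Fin n → A) := .pi_span_singleton a
  refine Module.Finite.of_surjective f (surjective_of_mkQ_comp_surjective (I := Ideal.span {a}) ?_)
  rw [hf]
  exact hg

open IsLocalRing in
theorem IsLocalRing.exists_fg_sup_maximalIdeal_pow_eq_top {A R : Type*} [CommRing A] [CommRing R]
    [IsNoetherianRing R] [IsLocalRing R] [Algebra A R]
    (hres : Function.Surjective ((residue R).comp (algebraMap A R))) (n : ℕ) :
    ∃ N : Submodule A R, N.FG ∧ N ⊔ (maximalIdeal R ^ n).restrictScalars A = ⊤ := by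
  induction n with
  | zero => exact ⟨⊥, Submodule.fg_bot, by simp⟩
  | succ n ih =>
    obtain ⟨N, hN, hsup⟩ := ih
    obtain ⟨S, hS⟩ := (isNoetherianRing_iff_ideal_fg R).1 inferInstance (maximalIdeal R ^ n)
    refine ⟨N ⊔ Submodule.span A S, hN.sup ⟨S, rfl⟩, ?_⟩
    suffices h : (maximalIdeal R ^ n).restrictScalars A ≤
        Submodule.span A S ⊔ (maximalIdeal R ^ (n + 1)).restrictScalars A by
      rw [eq_top_iff, ← hsup, sup_assoc]
      exact sup_le_sup_left h N
    intro x hx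
    rw [Submodule.restrictScalars_mem, ← hS] at hx
    induction hx using Submodule.span_induction with
    | mem x hx => exact Submodule.mem_sup_left (Submodule.subset_span hx)
    | zero => exact zero_mem _
    | add x y _ _ hx hy => exact add_mem hx hy
    | smul r x hx ih =>
      obtain ⟨a, ha⟩ := hres (residue R r)
      have hr : r - algebraMap A R a ∈ maximalIdeal R := by
        rw [← residue_eq_zero_iff, map_sub, sub_eq_zero]
        exact ha.symm
      have hdecomp : r • x = a • x + (r - algebraMap A R a) * x := by
        rw [smul_eq_mul, Algebra.smul_def]
        ring
      rw [hdecomp]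
      refine add_mem (Submodule.smul_mem _ a ih) (Submodule.mem_sup_right ?_)
      rw [Submodule.restrictScalars_mem, pow_succ']
      exact Ideal.mul_mem_mul hr (hS ▸ hx)

open IsLocalRing in
theorem IsLocalRing.finite_of_residue_surjective {A R : Type*} [CommRing A] [CommRing R]
    [IsNoetherianRing R] [IsLocalRing R] [IsDomain R] [Ring.KrullDimLE 1 R] [Algebra A R] (a : A)
    [IsPrecomplete (Ideal.span {a}) A] (ha : algebraMap A R a ∈ maximalIdeal R)
    (ha0 : algebraMap A R a ≠ 0)
    (hres : Function.Surjective ((residue R).comp (algebraMap A R))) : Module.Finite A R := by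
  have hmap : (Ideal.span {a}).map (algebraMap A R) = Ideal.span {algebraMap A R a} := by
    rw [Ideal.map_span, Set.image_singleton]
  have hle : Ideal.span {algebraMap A R a} ≤ maximalIdeal R := by
    rwa [Ideal.span_singleton_le_iff_mem]
  have : IsHausdorff (Ideal.span {a}) R := by
    rw [← IsHausdorff.map_algebraMap_iff (S := R), hmap]
    exact .of_isLocalRing _ _ (ne_top_of_le_ne_top Ideal.IsPrime.ne_top' hle)
  obtain ⟨n, hn⟩ : ∃ n, maximalIdeal R ^ n ≤ Ideal.span {algebraMap A R a} := by
    refine Ideal.exists_pow_le_of_le_radical_of_fg ?_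
      ((isNoetherianRing_iff_ideal_fg R).1 inferInstance _)
    rw [Ideal.radical_eq_sInf]
    refine le_sInf fun P ⟨hP, hprime⟩ => ?_
    have hbot : P ≠ ⊥ := by
      rintro rfl
      exact ha0 (by simpa using hP)
    exact (eq_maximalIdeal (hprime.isMaximal_of_ne_bot hbot)).ge
  obtain ⟨N, hN, hsup⟩ := exists_fg_sup_maximalIdeal_pow_eq_top hres n
  have hsmul : (Ideal.span {a} • ⊤ : Submodule A R) =
      (Ideal.span {algebraMap A R a}).restrictScalars A := by
    rw [Ideal.smul_top_eq_map, hmap]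
  have : Module.Finite A (R ⧸ (Ideal.span {a} • ⊤ : Submodule A R)) := by
    refine ⟨?_⟩
    have := hN.map (Submodule.mkQ (Ideal.span {a} • ⊤ : Submodule A R))
    rwa [(Submodule.map_mkQ_eq_top _ _).2] at this
    rw [hsmul, eq_top_iff, ← hsup, sup_comm]
    exact sup_le_sup_right (fun _ hx => hn hx) N
  exact .of_quotient_span_singleton_smul_top a

/-- The integral closure of a finite extension `R` of an integrally closed Noetherian domain `A` of
characteristic zero, in the fraction field of `R`, is finite over `A`. -/
theorem IsIntegralClosure.finite_of_module_finite {A R L C : Type*} [CommRing A] [IsDomain A]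
    [IsNoetherianRing A] [IsIntegrallyClosed A] [CharZero A] [CommRing R] [IsDomain R]
    [Algebra A R] [FaithfulSMul A R] [Module.Finite A R] [Field L] [Algebra R L]
    [IsFractionRing R L] [CommRing C] [Algebra C L] [Algebra R C] [IsScalarTower R C L]
    [IsIntegralClosure C R L] [Algebra A C] [IsScalarTower A R C] : Module.Finite A C := by
  let _ : Algebra A L := ((algebraMap R L).comp (algebraMap A R)).toAlgebra
  have : IsScalarTower A R L := .of_algebraMap_eq fun _ => rfl
  have : IsScalarTower A C L := .of_algebraMap_eq fun x => by
    rw [IsScalarTower.algebraMap_apply A R C, ← IsScalarTower.algebraMap_apply R C L]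
    rfl
  have : FaithfulSMul A L := (faithfulSMul_iff_algebraMap_injective A L).2 <|
    (IsFractionRing.injective R L).comp (FaithfulSMul.algebraMap_injective A R)
  let _ : Algebra (FractionRing A) L := FractionRing.liftAlgebra A L
  have : CharZero (FractionRing A) :=
    charZero_of_injective_algebraMap (IsFractionRing.injective A (FractionRing A))
  have : FiniteDimensional (FractionRing A) L := .of_isLocalization A R (nonZeroDivisors A)
  have : IsIntegralClosure C A L :=
    { algebraMap_injective := IsIntegralClosure.algebraMap_injective C R L
      isIntegral_iff := fun {x} => by
        rw [← IsIntegralClosure.isIntegral_iff (A := C) (R := R)]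
        exact ⟨fun h => h.tower_top, fun h => isIntegral_trans x h⟩ }
  exact IsIntegralClosure.finite A (FractionRing A) L C


set_option synthInstance.maxHeartbeats 1000000 in
/-- Let `(R, m)` be a commutative Noetherian complete local ring which is flat as a
`ℤ_p`-module, an integral domain of Krull dimension `1`, with perfect residue field
`k = R/m` of characteristic `p`. If `ι : W(k) → R` is an injective ring homomorphism
lifting the identity on residue fields, then the integral closure of `R` in its field of
fractions is a finitely generated `W(k)`-module. -/
theorem stmt4 (p : ℕ) [Fact p.Prime] (R : Type*) [CommRing R] [IsNoetherianRing R]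
    [IsLocalRing R] [IsAdicComplete (IsLocalRing.maximalIdeal R) R]
    [Algebra ℤ_[p] R] [Module.Flat ℤ_[p] R]
    [IsDomain R] (hdim : ringKrullDim R = 1)
    [CharP (IsLocalRing.ResidueField R) p] [PerfectRing (IsLocalRing.ResidueField R) p]
    [Algebra (WittVector p (IsLocalRing.ResidueField R)) R]
    (hinj : Function.Injective
      (algebraMap (WittVector p (IsLocalRing.ResidueField R)) R))
    (hres : ∀ w : WittVector p (IsLocalRing.ResidueField R),
      IsLocalRing.residue R (algebraMap (WittVector p (IsLocalRing.ResidueField R)) R w)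
        = w.coeff 0) :
    letI : Algebra (WittVector p (IsLocalRing.ResidueField R))
        (integralClosure R (FractionRing R)) :=
      ((algebraMap R (integralClosure R (FractionRing R))).comp
        (algebraMap (WittVector p (IsLocalRing.ResidueField R)) R)).toAlgebra
    Module.Finite (WittVector p (IsLocalRing.ResidueField R))
      (integralClosure R (FractionRing R)) := by
  let _ : Algebra (WittVector p (IsLocalRing.ResidueField R))
      (integralClosure R (FractionRing R)) :=
    ((algebraMap R (integralClosure R (FractionRing R))).comp
      (algebraMap (WittVector p (IsLocalRing.ResidueField R)) R)).toAlgebra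
  have : CharZero R :=
    charZero_of_injective_algebraMap (FaithfulSMul.algebraMap_injective ℤ_[p] R)
  have : CharZero (WittVector p (IsLocalRing.ResidueField R)) :=
    ⟨fun m n h => Nat.cast_injective (R := R) <| by
      simpa using congrArg (algebraMap (WittVector p (IsLocalRing.ResidueField R)) R) h⟩
  have : FaithfulSMul (WittVector p (IsLocalRing.ResidueField R)) R :=
    (faithfulSMul_iff_algebraMap_injective _ _).2 hinj
  have : Ring.KrullDimLE 1 R := Ring.krullDimLE_iff.2 hdim.le
  have : Module.Finite (WittVector p (IsLocalRing.ResidueField R)) R := by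
    refine IsLocalRing.finite_of_residue_surjective
      (p : WittVector p (IsLocalRing.ResidueField R)) ?_ ?_ fun x =>
        ⟨WittVector.teichmuller p x, ?_⟩
    · rw [map_natCast, ← IsLocalRing.residue_eq_zero_iff, map_natCast, CharP.cast_eq_zero]
    · rw [map_natCast]
      exact_mod_cast (Fact.out : p.Prime).ne_zero
    · rw [RingHom.comp_apply, hres, WittVector.teichmuller_coeff_zero]
  have : IsScalarTower (WittVector p (IsLocalRing.ResidueField R)) R
      (integralClosure R (FractionRing R)) := .of_algebraMap_eq fun _ => rfl
  exact IsIntegralClosure.finite_of_module_finite (R := R) (L := FractionRing R)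
end

section
/- Let R be a reduced Noetherian commutative ring and let r ∈ R. Then there exists s ∈ R such that r + s is a regular element of R (i.e. not a zero divisor) and r·s = 0. -/
/-- In a reduced ring, the only element annihilating both `r` and the annihilator of `r` is `0`. -/
theorem annihilator_span_singleton_sup_annihilator_eq_bot {R : Type*} [CommRing R] [IsReduced R]
    (r : R) :
    Module.annihilator R ↥(Ideal.span {r} ⊔ (Ideal.span {r}).annihilator) = ⊥ := by
  refine (Submodule.eq_bot_iff _).2 fun x hx ↦ ?_
  have hx := Submodule.mem_annihilator.1 hx
  have hxr : x * r = 0 :=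
    hx r (Submodule.mem_sup_left (Ideal.mem_span_singleton_self r))
  have hxx : x * x = 0 := hx x <| Submodule.mem_sup_right <|
    (Submodule.mem_annihilator_span_singleton r x).2 hxr
  exact IsReduced.eq_zero x ⟨2, by rw [sq, hxx]⟩

/-- In a reduced ring, if `r * t = 0` and `r * a + t` is regular, then so is `r + t`. -/
theorem add_mem_nonZeroDivisors_of_mul_add_mem {R : Type*} [CommRing R] [IsReduced R]
    {r t a : R} (hrt : r * t = 0) (h : r * a + t ∈ nonZeroDivisors R) :
    r + t ∈ nonZeroDivisors R := by
  refine mem_nonZeroDivisors_iff_right.2 fun x hx ↦ mem_nonZeroDivisors_iff_right.1 h x ?_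
  have hxr : x * r = 0 := IsReduced.eq_zero _ ⟨2, by linear_combination x * r * hx - x ^ 2 * hrt⟩
  linear_combination hx + (a - 1) * hxr

/-- Let `R` be a reduced Noetherian commutative ring and `r ∈ R`. Then there exists
`s ∈ R` such that `r + s` is a regular element (not a zero divisor) and `r * s = 0`. -/
theorem stmt5 (R : Type*) [CommRing R] [IsNoetherianRing R] [IsReduced R] (r : R) :
    ∃ s : R, (r + s) ∈ nonZeroDivisors R ∧ r * s = 0 := by
  obtain ⟨y, hy, hreg⟩ := Set.not_disjoint_iff.1 fun h ↦
    (Ideal.bot_lt_annihilator_of_disjoint_nonZeroDivisors h).ne'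
      (annihilator_span_singleton_sup_annihilator_eq_bot r)
  obtain ⟨u, hu, t, ht, rfl⟩ := Submodule.mem_sup.1 hy
  obtain ⟨a, rfl⟩ := Ideal.mem_span_singleton.1 hu
  have hrt : r * t = 0 := by
    rw [mul_comm]
    exact (Submodule.mem_annihilator_span_singleton r t).1 ht
  exact ⟨t, add_mem_nonZeroDivisors_of_mul_add_mem hrt hreg, hrt⟩
end

section
/- Let R be a reduced Noetherian commutative ring and let M be a torsion-free R-module, meaning that every regular element of R acts injectively on M. Then for every m ∈ M, the annihilator ideal ann_R(m) = {r ∈ R : r·m = 0} is a radical ideal of R; equivalently, for every r ∈ R, every n ≥ 1 and every m ∈ M, if rⁿ·m = 0 then r·m = 0. -/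
/-- In a reduced Noetherian ring, for every `r` and `n`, the ideal generated by `r ^ n` together
with the annihilator of `r` contains a regular element. -/
theorem exists_mul_pow_add_mem_nonZeroDivisors {R : Type*} [CommRing R] [IsNoetherianRing R]
    [IsReduced R] (r : R) (n : ℕ) :
    ∃ a s : R, s * r = 0 ∧ a * r ^ n + s ∈ nonZeroDivisors R := by
  have hbot : (Ideal.span {r ^ n} ⊔ Ideal.torsionOf R R r).annihilator = ⊥ := by
    refine eq_bot_iff.2 fun x hx ↦ ?_
    rw [Submodule.mem_annihilator] at hx
    have hxr : x * r = 0 := by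
      have hpow : x * r ^ n = 0 :=
        hx _ (Ideal.mem_sup_left (Ideal.mem_span_singleton_self _))
      refine IsReduced.eq_zero _ ⟨n + 1, ?_⟩
      rw [mul_pow, pow_succ x, pow_succ r]
      linear_combination x ^ n * r * hpow
    exact IsReduced.eq_zero _ ⟨2, (sq x).trans (hx x (Ideal.mem_sup_right hxr))⟩
  obtain ⟨t, ht, htreg⟩ : ∃ t ∈ Ideal.span {r ^ n} ⊔ Ideal.torsionOf R R r,
      t ∈ nonZeroDivisors R := by
    by_contra! h
    have := Ideal.bot_lt_annihilator_of_disjoint_nonZeroDivisors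
      (Set.disjoint_left.2 h)
    exact this.ne' hbot
  obtain ⟨y, hy, s, hs, rfl⟩ := Submodule.mem_sup.1 ht
  obtain ⟨a, rfl⟩ := Ideal.mem_span_singleton'.1 hy
  exact ⟨a, s, hs, htreg⟩

/-- Let `R` be a reduced Noetherian commutative ring and `M` a torsion-free `R`-module
(every regular element of `R` acts injectively on `M`). Then for every `m ∈ M` the
annihilator of `m` is a radical ideal; equivalently, for every `r : R`, `n ≥ 1` and
`m : M`, if `r ^ n • m = 0` then `r • m = 0`. -/
theorem stmt6 (R : Type*) [CommRing R] [IsNoetherianRing R] [IsReduced R]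
    (M : Type*) [AddCommGroup M] [Module R M]
    (htf : ∀ r ∈ nonZeroDivisors R, ∀ m : M, r • m = 0 → m = 0) :
    (∀ m : M, (Ideal.torsionOf R M m).IsRadical) ∧
    (∀ (r : R) (n : ℕ) (m : M), 1 ≤ n → r ^ n • m = 0 → r • m = 0) := by
  have key : ∀ (r : R) (n : ℕ) (m : M), r ^ n • m = 0 → r • m = 0 := by
    intro r n m h
    obtain ⟨a, s, hs, hreg⟩ := exists_mul_pow_add_mem_nonZeroDivisors r n
    refine htf _ hreg _ ?_
    rw [add_smul, smul_smul s, hs, zero_smul, add_zero, smul_comm, mul_smul, h, smul_zero,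
      smul_zero]
  exact ⟨fun m r ⟨n, hn⟩ ↦ key r n m hn, fun r n m _ h ↦ key r n m h⟩
end

section
/- Let K be a field, m a positive integer, and let μ, ν be partitions of m with associated nilpotent Jordan matrices N_μ(K) and N_ν(K). Then rank(N_μ(K)^i) ≤ rank(N_ν(K)^i) for all integers i with 1 ≤ i ≤ m − 1 if and only if μ is dominated by ν, i.e. Σ_{j=1}^{k} μ_j ≤ Σ_{j=1}^{k} ν_j for every integer k ≥ 1 (where parts beyond the length of a partition are taken to be 0). -/
/-- The nilpotent Jordan block of size `s`. -/
def jordanBlock (K : Type*) [Field K] (s : ℕ) : Matrix (Fin s) (Fin s) K :=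
  Matrix.of fun a b => if (a : ℕ) + 1 = (b : ℕ) then 1 else 0

/-- The block-diagonal nilpotent matrix in Jordan normal form with block sizes `μ`. -/
def jordanMatrix (K : Type*) [Field K] {r : ℕ} (μ : Fin r → ℕ) :
    Matrix (Σ j : Fin r, Fin (μ j)) (Σ j : Fin r, Fin (μ j)) K :=
  Matrix.blockDiagonal' fun j => jordanBlock K (μ j)

/-- The `k`-th partial sum `μ₁ + ⋯ + μ_k` of a partition `μ`, where parts beyond the
length of the partition are taken to be `0`. -/
def partSum {r : ℕ} (μ : Fin r → ℕ) (k : ℕ) : ℕ :=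
  ∑ j ∈ Finset.range k, if h : j < r then μ ⟨j, h⟩ else 0

/-- The function on `ℕ` extending a finite sequence by zero. -/
def zeroExtend {r : ℕ} (μ : Fin r → ℕ) (j : ℕ) : ℕ :=
  if h : j < r then μ ⟨j, h⟩ else 0

lemma zeroExtend_of_le {r : ℕ} (μ : Fin r → ℕ) {j : ℕ} (h : r ≤ j) : zeroExtend μ j = 0 :=
  dif_neg h.not_gt

lemma Antitone.zeroExtend {r : ℕ} {μ : Fin r → ℕ} (hμ : Antitone μ) :
    Antitone (zeroExtend μ) := by
  intro a b hab
  unfold _root_.zeroExtend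
  split_ifs with hb ha
  · exact hμ (by simpa using hab)
  · omega
  · exact Nat.zero_le _
  · rfl

lemma partSum_eq_sum_zeroExtend {r : ℕ} (μ : Fin r → ℕ) (k : ℕ) :
    partSum μ k = ∑ j ∈ Finset.range k, zeroExtend μ j := rfl

lemma sum_tsub_eq_sum_range_zeroExtend {r : ℕ} (μ : Fin r → ℕ) (i : ℕ) :
    ∑ j, (μ j - i) = ∑ j ∈ Finset.range r, (zeroExtend μ j - i) := by
  rw [Finset.sum_range]
  simp [zeroExtend]

lemma sum_range_tsub_le {r : ℕ} (μ : Fin r → ℕ) (i k : ℕ) :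
    ∑ j ∈ Finset.range k, (zeroExtend μ j - i) ≤ ∑ j, (μ j - i) := by
  rw [sum_tsub_eq_sum_range_zeroExtend]
  apply Finset.sum_le_sum_of_ne_zero
  intro j _ hj
  rw [Finset.mem_range]
  by_contra! h
  simp [zeroExtend_of_le μ h] at hj

lemma partSum_le_sum_tsub_add {r : ℕ} (μ : Fin r → ℕ) (i k : ℕ) :
    partSum μ k ≤ ∑ j, (μ j - i) + k * i := by
  calc partSum μ k ≤ ∑ j ∈ Finset.range k, ((zeroExtend μ j - i) + i) :=
        Finset.sum_le_sum fun j _ => le_tsub_add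
    _ = ∑ j ∈ Finset.range k, (zeroExtend μ j - i) + k * i := by
        simp [Finset.sum_add_distrib]
    _ ≤ _ := Nat.add_le_add_right (sum_range_tsub_le μ i k) _

lemma partSum_eq_sum_tsub_add {r : ℕ} (μ : Fin r → ℕ) (i k : ℕ)
    (hlt : ∀ j < k, i ≤ zeroExtend μ j) (hge : ∀ j, k ≤ j → zeroExtend μ j ≤ i) :
    partSum μ k = ∑ j, (μ j - i) + k * i := by
  refine (partSum_le_sum_tsub_add μ i k).antisymm ?_
  calc ∑ j, (μ j - i) + k * i
      ≤ ∑ j ∈ Finset.range k, (zeroExtend μ j - i) + k * i := by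
        rw [sum_tsub_eq_sum_range_zeroExtend]
        refine Nat.add_le_add_right (Finset.sum_le_sum_of_ne_zero ?_) _
        intro j _ hj
        rw [Finset.mem_range]
        by_contra! h
        exact hj (Nat.sub_eq_zero_of_le (hge j h))
    _ = ∑ j ∈ Finset.range k, ((zeroExtend μ j - i) + i) := by
        simp [Finset.sum_add_distrib]
    _ = partSum μ k := Finset.sum_congr rfl fun j hj =>
        Nat.sub_add_cancel (hlt j (Finset.mem_range.1 hj))

lemma forall_sum_tsub_le_iff_forall_partSum_le {r s : ℕ} {μ : Fin r → ℕ} {ν : Fin s → ℕ}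
    (hμ : Antitone μ) (hν : Antitone ν) :
    (∀ i, ∑ j, (μ j - i) ≤ ∑ j, (ν j - i)) ↔ ∀ k, partSum μ k ≤ partSum ν k := by
  constructor
  · intro h k
    rw [partSum_eq_sum_tsub_add ν (zeroExtend ν k) k (fun j hj => hν.zeroExtend hj.le)
      (fun j hj => hν.zeroExtend hj)]
    exact (partSum_le_sum_tsub_add μ _ k).trans (Nat.add_le_add_right (h _) _)
  · intro h i
    have hex : ∃ k, zeroExtend μ k ≤ i := ⟨r, by simp [zeroExtend_of_le μ le_rfl]⟩
    have heq := partSum_eq_sum_tsub_add μ i (Nat.find hex)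
      (fun j hj => (not_le.1 (Nat.find_min hex hj)).le)
      (fun j hj => (hμ.zeroExtend hj).trans (Nat.find_spec hex))
    have hle := partSum_le_sum_tsub_add ν i (Nat.find hex)
    have := h (Nat.find hex)
    omega

lemma jordanBlock_apply (K : Type*) [Field K] (n : ℕ) (a b : Fin n) :
    jordanBlock K n a b = if (a : ℕ) + 1 = b then 1 else 0 := rfl

lemma jordanBlock_pow_apply (K : Type*) [Field K] (n i : ℕ) (a b : Fin n) :
    (jordanBlock K n ^ i) a b = if (a : ℕ) + i = b then 1 else 0 := by
  induction i generalizing a with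
  | zero => simp [Matrix.one_apply, Fin.ext_iff]
  | succ i ih =>
    simp only [pow_succ', Matrix.mul_apply, ih, jordanBlock_apply, ite_mul, one_mul,
      zero_mul]
    by_cases ha : (a : ℕ) + 1 < n
    · rw [Finset.sum_eq_single (⟨a + 1, ha⟩ : Fin n)]
      · simp [add_assoc, add_comm 1 i]
      · intro c _ hc
        rw [if_neg]
        exact fun h => hc (Fin.ext h.symm)
      · simp
    · rw [Finset.sum_eq_zero, if_neg]
      · omega
      · intro c _
        rw [if_neg]
        omega

lemma jordanMatrix_pow_apply (K : Type*) [Field K] {r : ℕ} (μ : Fin r → ℕ) (i : ℕ)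
    (x y : Σ j : Fin r, Fin (μ j)) :
    (jordanMatrix K μ ^ i) x y = if x.1 = y.1 ∧ (x.2 : ℕ) + i = y.2 then 1 else 0 := by
  obtain ⟨j, a⟩ := x
  obtain ⟨j', b⟩ := y
  rw [jordanMatrix, ← Matrix.blockDiagonal'_pow, Matrix.blockDiagonal'_apply]
  by_cases h : j = j'
  · subst h
    simp [jordanBlock_pow_apply]
  · simp [h]

lemma card_sigma_fin_le {r : ℕ} (μ : Fin r → ℕ) (i : ℕ) :
    Fintype.card {y : Σ j : Fin r, Fin (μ j) // i ≤ (y.2 : ℕ)} = ∑ j, (μ j - i) := by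
  have e : {y : Σ j : Fin r, Fin (μ j) // i ≤ (y.2 : ℕ)} ≃ Σ j : Fin r, Fin (μ j - i) :=
    { toFun := fun y => ⟨y.1.1, ⟨y.1.2 - i, by have := y.1.2.2; have := y.2; omega⟩⟩
      invFun := fun z => ⟨⟨z.1, ⟨z.2 + i, by have := z.2.2; omega⟩⟩, by simp⟩
      left_inv := by
        rintro ⟨⟨j, b⟩, hb⟩
        simp only [Subtype.mk.injEq, Sigma.mk.injEq, heq_eq_eq, true_and, Fin.ext_iff]
        exact Nat.sub_add_cancel hb
      right_inv := by
        rintro ⟨j, b⟩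
        simp }
  simp [Fintype.card_congr e]

lemma rank_jordanMatrix_pow (K : Type*) [Field K] {r : ℕ} (μ : Fin r → ℕ) (i : ℕ) :
    (jordanMatrix K μ ^ i).rank = ∑ j, (μ j - i) := by
  classical
  have hli : LinearIndependent K
      (fun y : {y : Σ j : Fin r, Fin (μ j) // i ≤ (y.2 : ℕ)} =>
        Pi.basisFun K (Σ j : Fin r, Fin (μ j)) y) :=
    (Pi.basisFun K _).linearIndependent.comp _ Subtype.val_injective
  rw [← card_sigma_fin_le, ← finrank_span_eq_card hli, Matrix.rank_eq_finrank_span_row]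
  refine congrArg (fun S : Submodule K (_ → K) => Module.finrank K S) (le_antisymm ?_ ?_)
  · rw [Submodule.span_le]
    rintro _ ⟨⟨j, a⟩, rfl⟩
    by_cases ha : (a : ℕ) + i < μ j
    · refine Submodule.subset_span ⟨⟨⟨j, ⟨a + i, ha⟩⟩, by simp⟩, ?_⟩
      ext ⟨j', b⟩
      simp only [Pi.basisFun_apply, Pi.single_apply, Matrix.row, jordanMatrix_pow_apply]
      congr 1
      by_cases h : j = j'
      · subst h
        simp [Fin.ext_iff, eq_comm]
      · simp [h, Ne.symm h]
    · have : (jordanMatrix K μ ^ i).row ⟨j, a⟩ = 0 := by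
        ext ⟨j', b⟩
        simp only [Matrix.row, jordanMatrix_pow_apply, Pi.zero_apply]
        rw [if_neg]
        rintro ⟨h, h'⟩
        subst h
        omega
      rw [this]
      exact Submodule.zero_mem _
  · rw [Submodule.span_le]
    rintro _ ⟨⟨⟨j, b⟩, hb⟩, rfl⟩
    refine Submodule.subset_span ⟨⟨j, ⟨b - i, by omega⟩⟩, ?_⟩
    ext ⟨j', c⟩
    simp only [Pi.basisFun_apply, Pi.single_apply, Matrix.row, jordanMatrix_pow_apply]
    congr 1
    by_cases h : j = j'
    · subst h
      simp only [true_and, Sigma.mk.injEq, heq_eq_eq, Fin.ext_iff, eq_iff_iff]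
      dsimp only at hb
      omega
    · simp [h, Ne.symm h]

/-- Let `K` be a field, `m` a positive integer, and `μ, ν` partitions of `m`. Then
`rank (N_μ(K) ^ i) ≤ rank (N_ν(K) ^ i)` for all `1 ≤ i ≤ m - 1` if and only if `μ` is
dominated by `ν`: `μ₁ + ⋯ + μ_k ≤ ν₁ + ⋯ + ν_k` for every `k ≥ 1`. -/
theorem stmt9 (K : Type*) [Field K] (m : ℕ) (hm : 0 < m)
    (r : ℕ) (μ : Fin r → ℕ) (hμmono : Antitone μ) (hμpos : ∀ j, 0 < μ j)
    (hμsum : ∑ j, μ j = m)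
    (s : ℕ) (ν : Fin s → ℕ) (hνmono : Antitone ν) (hνpos : ∀ j, 0 < ν j)
    (hνsum : ∑ j, ν j = m) :
    (∀ i : ℕ, 1 ≤ i → i ≤ m - 1 →
        ((jordanMatrix K μ) ^ i).rank ≤ ((jordanMatrix K ν) ^ i).rank) ↔
      (∀ k : ℕ, 1 ≤ k → partSum μ k ≤ partSum ν k) := by
  have h_rank : (∀ i : ℕ, 1 ≤ i → i ≤ m - 1 →
        ((jordanMatrix K μ) ^ i).rank ≤ ((jordanMatrix K ν) ^ i).rank) ↔
      ∀ i, ∑ j, (μ j - i) ≤ ∑ j, (ν j - i) := by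
    simp only [rank_jordanMatrix_pow]
    refine ⟨fun h i => ?_, fun h i _ _ => h i⟩
    rcases Nat.eq_zero_or_pos i with rfl | hi
    · simp [hμsum, hνsum]
    rcases le_or_gt i (m - 1) with him | him
    · exact h i hi him
    · rw [Finset.sum_eq_zero]
      · exact Nat.zero_le _
      · intro j _
        have := Finset.single_le_sum (f := μ) (fun _ _ => Nat.zero_le _) (Finset.mem_univ j)
        omega
  rw [h_rank, forall_sum_tsub_le_iff_forall_partSum_le hμmono hνmono]
  refine ⟨fun h k _ => h k, fun h k => ?_⟩
  rcases Nat.eq_zero_or_pos k with rfl | hk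
  · simp [partSum]
  · exact h k hk
end

section
/- Let K be a field of characteristic 0, let N and N₁ be nilpotent n × n matrices over K, and let N' be a nilpotent m × m matrix over K. If rank(N^i) ≤ rank(N₁^i) for every integer i ≥ 1, then rank((N ⊗ I_m + I_n ⊗ N')^j) ≤ rank((N₁ ⊗ I_m + I_n ⊗ N')^j) for every integer j ≥ 1; that is, the Jordan type of the Kronecker sum N ⊗ I_m + I_n ⊗ N' depends monotonically (for the dominance order) on the Jordan type of N. -/
open Kronecker

open Polynomial

/-- Smith normal form of a square matrix with nonzero determinant over a principal ideal domain. -/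
theorem Matrix.exists_eq_mul_diagonal_mul_of_det_ne_zero {R : Type*} [CommRing R] [IsDomain R]
    [IsPrincipalIdealRing R] {ι : Type*} [Fintype ι] [DecidableEq ι] (A : Matrix ι ι R)
    (hA : A.det ≠ 0) :
    ∃ (P Q : Matrix ι ι R) (d : ι → R), IsUnit P ∧ IsUnit Q ∧ A = P * diagonal d * Q := by
  have hinj : Function.Injective (toLin' A) := by
    rw [toLin'_apply', coe_mulVecLin]
    exact mulVec_injective_of_det_ne_zero hA
  let b := Pi.basisFun R ι
  obtain ⟨c, d, e', he'⟩ := (toLin' A).range.exists_smith_normal_form_of_rank_eq b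
    (LinearMap.finrank_range_of_inj hinj)
  let e := e'.map (LinearEquiv.ofInjective (toLin' A) hinj).symm
  have he : ∀ i, toLin' A (e i) = d i • c i := fun i ↦ by
    rw [← he' i]
    exact congrArg Subtype.val ((LinearEquiv.ofInjective (toLin' A) hinj).apply_symm_apply (e' i))
  have hdiag : LinearMap.toMatrix e c (toLin' A) = diagonal d := by
    ext i j
    rw [LinearMap.toMatrix_apply, he, map_smul, Finsupp.smul_apply, c.repr_self,
      Finsupp.single_apply, diagonal_apply]
    aesop
  have hunit : ∀ b₁ b₂ : Module.Basis ι R (ι → R), IsUnit (b₁.toMatrix b₂) := fun b₁ b₂ ↦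
    ⟨⟨b₁.toMatrix b₂, b₂.toMatrix b₁, b₁.toMatrix_mul_toMatrix_flip b₂,
      b₂.toMatrix_mul_toMatrix_flip b₁⟩, rfl⟩
  refine ⟨b.toMatrix c, e.toMatrix b, d, hunit _ _, hunit _ _, ?_⟩
  rw [← hdiag, basis_toMatrix_mul_linearMap_toMatrix_mul_basis_toMatrix]
  exact (LinearMap.toMatrix'_toLin' A).symm

/-- The rank of a block diagonal matrix is the sum of the ranks of its blocks. -/
theorem Matrix.rank_comp_diagonal {K ι κ : Type*} [Field K] [Fintype ι] [DecidableEq ι]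
    [Fintype κ] (D : ι → Matrix κ κ K) :
    (comp ι ι κ κ K (diagonal D)).rank = ∑ i, (D i).rank := by
  have hmul : ∀ (v : ι × κ → K) (i : ι) (a : κ),
      (comp ι ι κ κ K (diagonal D)).mulVec v (i, a) = (D i).mulVec (fun b ↦ v (i, b)) a := by
    intro v i a
    simp only [mulVec, dotProduct, Fintype.sum_prod_type, comp_apply]
    rw [Finset.sum_eq_single i (fun j _ hj ↦ by simp [diagonal_apply_ne' _ hj]) (by simp)]
    simp
  let φ : (comp ι ι κ κ K (diagonal D)).mulVecLin.ker ≃ₗ[K] ∀ i, (D i).mulVecLin.ker :=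
    { toFun v i := ⟨fun b ↦ v.1 (i, b), by
        ext a
        have := congrFun (LinearMap.mem_ker.1 v.2) (i, a)
        rwa [mulVecLin_apply, hmul] at this⟩
      invFun w := ⟨fun p ↦ (w p.1).1 p.2, by
        ext ⟨i, a⟩
        rw [mulVecLin_apply, hmul]
        exact congrFun (LinearMap.mem_ker.1 (w i).2) a⟩
      map_add' _ _ := rfl
      map_smul' _ _ := rfl
      left_inv _ := rfl
      right_inv _ := rfl }
  have hker := φ.finrank_eq
  rw [Module.finrank_pi_fintype] at hker
  have h₁ := (comp ι ι κ κ K (diagonal D)).mulVecLin.finrank_range_add_finrank_ker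
  have h₂ : ∑ i, (D i).rank + ∑ i, Module.finrank K (D i).mulVecLin.ker =
      Module.finrank K (ι × κ → K) := by
    rw [← Finset.sum_add_distrib]
    simp [rank, LinearMap.finrank_range_add_finrank_ker]
  rw [rank]
  omega

theorem Matrix.rank_mul_eq_of_isUnit {K ι : Type*} [Field K] [Fintype ι] [DecidableEq ι]
    {P Q : Matrix ι ι K} (A : Matrix ι ι K) (hP : IsUnit P) (hQ : IsUnit Q) :
    (P * A * Q).rank = A.rank := by
  rw [rank_mul_eq_left_of_isUnit_det _ _ ((isUnit_iff_isUnit_det Q).1 hQ),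
    rank_mul_eq_right_of_isUnit_det _ _ ((isUnit_iff_isUnit_det P).1 hP)]

theorem Matrix.det_scalar_X_add_map_C_of_isNilpotent {K ι : Type*} [Field K] [Fintype ι]
    [DecidableEq ι] {N : Matrix ι ι K} (hN : IsNilpotent N) :
    (scalar ι (X : K[X]) + N.map C).det = X ^ Fintype.card ι := by
  have h := ((isNilpotent_toLin'_iff (-N)).2 hN.neg).charpoly_eq_X_pow_finrank
  rw [charpoly_toLin', Module.finrank_fintype_fun_eq_card] at h
  rw [← h, charpoly, charmatrix]
  congr 1
  ext
  simp

/-- The ranks of the powers of the Kronecker sum of a matrix `N` with a fixed nilpotent matrix are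
sums of ranks of powers of `N`, with exponents that do not depend on `N`. -/
theorem Matrix.exists_rank_kroneckerSum_pow_eq {K ι κ : Type*} [Field K] [Fintype ι]
    [DecidableEq ι] [Fintype κ] [DecidableEq κ] {N' : Matrix ι ι K} (hN' : IsNilpotent N') (j : ℕ) :
    ∃ s : ι → ℕ, ∀ N : Matrix κ κ K,
      ((N ⊗ₖ (1 : Matrix ι ι K) + (1 : Matrix κ κ K) ⊗ₖ N') ^ j).rank =
        ∑ i, (N ^ s i).rank := by
  let A : Matrix ι ι K[X] := scalar ι X + N'.map C
  have hdet : (A ^ j).det = X ^ (Fintype.card ι * j) := by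
    rw [det_pow, det_scalar_X_add_map_C_of_isNilpotent hN', ← pow_mul]
  obtain ⟨P, Q, d, hP, hQ, hA⟩ := (A ^ j).exists_eq_mul_diagonal_mul_of_det_ne_zero
    (hdet ▸ pow_ne_zero _ X_ne_zero)
  have hd : ∀ i, ∃ s, Associated (X ^ s) (d i) := fun i ↦ by
    have hdvd : d i ∣ X ^ (Fintype.card ι * j) := by
      rw [← hdet, hA, det_mul, det_mul, det_diagonal]
      exact ((Finset.dvd_prod_of_mem d (Finset.mem_univ i)).mul_left _).mul_right _
    obtain ⟨s, -, hs⟩ := (dvd_prime_pow prime_X _).1 hdvd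
    exact ⟨s, hs.symm⟩
  choose s hs using hd
  refine ⟨s, fun N ↦ ?_⟩
  let Φ : Matrix ι ι K[X] →+* Matrix (ι × κ) (ι × κ) K :=
    (compRingEquiv ι κ K).toRingHom.comp (aeval N).toRingHom.mapMatrix
  have hΦA : Φ A = (N ⊗ₖ (1 : Matrix ι ι K) + (1 : Matrix κ κ K) ⊗ₖ N').submatrix
      (Equiv.prodComm ι κ) (Equiv.prodComm ι κ) := by
    ext ⟨i, a⟩ ⟨k, b⟩
    by_cases hik : i = k <;>
      simp [Φ, A, hik, kroneckerMap_apply, one_apply, algebraMap_matrix_apply]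
  have hΦd : Φ (diagonal d) = comp ι ι κ κ K (diagonal fun i ↦ aeval N (d i)) := by
    simp [Φ, diagonal_map]
  have hrank : ∀ i, (aeval N (d i)).rank = (N ^ s i).rank := fun i ↦ by
    obtain ⟨u, hu⟩ := hs i
    rw [← hu, map_mul, map_pow, aeval_X, rank_mul_eq_left_of_isUnit_det _ _
      ((isUnit_iff_isUnit_det _).1 (u.isUnit.map (aeval N)))]
  calc _ = (((N ⊗ₖ (1 : Matrix ι ι K) + (1 : Matrix κ κ K) ⊗ₖ N') ^ j).submatrix
        (Equiv.prodComm ι κ) (Equiv.prodComm ι κ)).rank := (rank_submatrix _ _ _).symm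
    _ = (Φ (A ^ j)).rank := by
      rw [map_pow, hΦA]
      exact congrArg rank (map_pow (reindexAlgEquiv K K (Equiv.prodComm κ ι)) _ j)
    _ = ∑ i, (N ^ s i).rank := by
      rw [hA, map_mul, map_mul, rank_mul_eq_of_isUnit _ (hP.map Φ) (hQ.map Φ), hΦd,
        rank_comp_diagonal]
      exact Finset.sum_congr rfl fun i _ ↦ hrank i

/-- Let `K` be a field of characteristic `0`, let `N` and `N₁` be nilpotent `n × n`
matrices over `K`, and `N'` a nilpotent `m × m` matrix over `K`. If
`rank (N ^ i) ≤ rank (N₁ ^ i)` for all `i ≥ 1`, then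
`rank ((N ⊗ I + I ⊗ N') ^ j) ≤ rank ((N₁ ⊗ I + I ⊗ N') ^ j)` for all `j ≥ 1`: the Jordan
type of the Kronecker sum depends monotonically on the Jordan type of `N`. -/
theorem stmt12 (K : Type*) [Field K] [CharZero K] (n m : ℕ)
    (N N₁ : Matrix (Fin n) (Fin n) K) (N' : Matrix (Fin m) (Fin m) K)
    (hN : IsNilpotent N) (hN₁ : IsNilpotent N₁) (hN' : IsNilpotent N')
    (h : ∀ i : ℕ, 1 ≤ i → (N ^ i).rank ≤ (N₁ ^ i).rank) :
    ∀ j : ℕ, 1 ≤ j →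
      ((N ⊗ₖ (1 : Matrix (Fin m) (Fin m) K) +
          (1 : Matrix (Fin n) (Fin n) K) ⊗ₖ N') ^ j).rank ≤
        ((N₁ ⊗ₖ (1 : Matrix (Fin m) (Fin m) K) +
          (1 : Matrix (Fin n) (Fin n) K) ⊗ₖ N') ^ j).rank := by
  intro j _
  obtain ⟨s, hs⟩ := Matrix.exists_rank_kroneckerSum_pow_eq (κ := Fin n) hN' j
  rw [hs, hs]
  refine Finset.sum_le_sum fun i _ ↦ ?_
  rcases Nat.eq_zero_or_pos (s i) with h0 | h0
  · simp [h0]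
  · exact h _ h0
end
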